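/- arXiv:2211.04204 — 7 statements merged into one kernel-verified Lean document; each statement's English description precedes it below -/
import Mathlib

section
/- Let V be the real vector space of finitely supported sequences m : ℕ → ℝ³, and for k ∈ ℕ, l ∈ {1,2,3} let f^{k,l} : V → V be the control vector field of the Galerkin LLG system, defined componentwise by (f^{k,l}(m))_i = (m_{k+i} + m_{|k−i|}) × e_l. With the vector-field Lie bracket [A,B] := B∘A − A∘B on linear maps, one has [f^{0,1}, f^{0,2}] = 2·f^{0,3}. -/
/-- The standard basis vectors `e_1, e_2, e_3` of `ℝ³` (indexed by `Fin 3`). -/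
noncomputable def stdBasis (l : Fin 3) : Fin 3 → ℝ := Pi.single l 1

/-- The control vector field `f^{k,l}` on the space `V = ℕ →₀ ℝ³` of finitely supported
sequences, given componentwise by `(f^{k,l}(m))_i = (m_{k+i} + m_{|k−i|}) × e_l`. -/
noncomputable def controlField (k : ℕ) (l : Fin 3) :
    (ℕ →₀ (Fin 3 → ℝ)) →ₗ[ℝ] (ℕ →₀ (Fin 3 → ℝ)) where
  toFun m := Finsupp.onFinset (Finset.range (m.support.sup id + k + 1))
    (fun i => crossProduct (m (k + i) + m (Nat.dist k i)) (stdBasis l))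
    (fun i hi => by
      have hne : m (k + i) ≠ 0 ∨ m (Nat.dist k i) ≠ 0 := by
        by_contra hc
        push_neg at hc
        exact hi (by simp [hc.1, hc.2])
      have hsup : ∀ n, m n ≠ 0 → n ≤ m.support.sup id := fun n hn =>
        Finset.le_sup (f := id) (Finsupp.mem_support_iff.mpr hn)
      rw [Finset.mem_range]
      rcases hne with h | h
      · have := hsup _ h
        omega
      · have h1 := hsup _ h
        have h2 : i ≤ k + Nat.dist k i := by
          rcases Nat.le_total k i with hki | hki
          · rw [Nat.dist_eq_sub_of_le hki]
            omega
          · omega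
        omega)
  map_add' m m' := Finsupp.ext fun i => by
    simp only [Finsupp.onFinset_apply, Finsupp.add_apply]
    rw [show m (k + i) + m' (k + i) + (m (Nat.dist k i) + m' (Nat.dist k i))
        = m (k + i) + m (Nat.dist k i) + (m' (k + i) + m' (Nat.dist k i)) from by abel,
      map_add]
    rfl
  map_smul' c m := Finsupp.ext fun i => by
    simp only [Finsupp.onFinset_apply, Finsupp.smul_apply, RingHom.id_apply]
    rw [← smul_add, map_smul]
    rfl

theorem controlField_zero_apply (l : Fin 3) (m : ℕ →₀ (Fin 3 → ℝ)) (i : ℕ) :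
    controlField 0 l m i = crossProduct (m i + m i) (stdBasis l) := by
  have h : controlField 0 l m i
      = crossProduct (m (0 + i) + m (Nat.dist 0 i)) (stdBasis l) := rfl
  rw [h, Nat.zero_add, Nat.dist_zero_left]

/-- `[f^{0,1}, f^{0,2}] = 2·f^{0,3}`, where `[A,B] = B∘A − A∘B`. -/
theorem bracket_f01_f02 :
    controlField 0 1 ∘ₗ controlField 0 0 - controlField 0 0 ∘ₗ controlField 0 1
      = (2 : ℝ) • controlField 0 2 := by
  refine LinearMap.ext fun m => Finsupp.ext fun i => ?_
  simp only [LinearMap.sub_apply, LinearMap.comp_apply, LinearMap.smul_apply,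
    Finsupp.sub_apply, Finsupp.smul_apply, controlField_zero_apply]
  ext j
  fin_cases j <;> simp [cross_apply, stdBasis, Pi.single_apply] <;> ring
end

section
/- Let V be the real vector space of finitely supported sequences m : ℕ → ℝ³, and for k ∈ ℕ, l ∈ {1,2,3} let f^{k,l} : V → V be defined by (f^{k,l}(m))_i = (m_{k+i} + m_{|k−i|}) × e_l. With the bracket [A,B] := B∘A − A∘B, one has [f^{1,1}, f^{0,2}] = 2·f^{1,3}. -/
/-- `[f^{1,1}, f^{0,2}] = 2·f^{1,3}`, where `[A,B] = B∘A − A∘B`. -/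
theorem bracket_f11_f02 :
    controlField 0 1 ∘ₗ controlField 1 0 - controlField 1 0 ∘ₗ controlField 0 1
      = (2 : ℝ) • controlField 1 2 := by
  have happ : ∀ (k : ℕ) (l : Fin 3) (m : ℕ →₀ (Fin 3 → ℝ)) (i : ℕ),
      controlField k l m i
        = crossProduct (m (k + i) + m (Nat.dist k i)) (stdBasis l) := fun _ _ _ _ => rfl
  refine LinearMap.ext fun m => Finsupp.ext fun i => ?_
  have h0 : ∀ j, Nat.dist 0 j = j := fun j => by simp [Nat.dist]
  simp only [LinearMap.sub_apply, LinearMap.comp_apply, LinearMap.smul_apply,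
    Finsupp.sub_apply, Finsupp.smul_apply, happ, h0, zero_add]
  generalize m (1 + i) = a
  generalize m (Nat.dist 1 i) = b
  ext j
  fin_cases j <;> simp [cross_apply, stdBasis, Pi.single_apply] <;> ring
end

section
/- Let V be the real vector space of finitely supported sequences m : ℕ → ℝ³, and for k ∈ ℕ, l ∈ {1,2,3} let f^{k,l} : V → V be defined by (f^{k,l}(m))_i = (m_{k+i} + m_{|k−i|}) × e_l. With the bracket [A,B] := B∘A − A∘B, one has [f^{1,1}, f^{0,3}] = −2·f^{1,2}. -/
/-- `[f^{1,1}, f^{0,3}] = −2·f^{1,2}`, where `[A,B] = B∘A − A∘B`. -/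
theorem bracket_f11_f03 :
    controlField 0 2 ∘ₗ controlField 1 0 - controlField 1 0 ∘ₗ controlField 0 2
      = (-2 : ℝ) • controlField 1 1 := by
  have key : ∀ (k : ℕ) (l : Fin 3) (m : ℕ →₀ (Fin 3 → ℝ)) (i : ℕ),
      controlField k l m i = crossProduct (m (k + i) + m (Nat.dist k i)) (stdBasis l) :=
    fun _ _ _ _ => rfl
  have h0 : ∀ i, Nat.dist 0 i = i := fun i => by simp [Nat.dist]
  refine LinearMap.ext fun m => Finsupp.ext fun i => ?_
  simp only [LinearMap.sub_apply, LinearMap.comp_apply, LinearMap.smul_apply,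
    Finsupp.sub_apply, Finsupp.smul_apply, key, h0, zero_add]
  generalize m (1 + i) = a
  generalize m (Nat.dist 1 i) = b
  ext j
  fin_cases j <;> simp [crossProduct, stdBasis, Pi.single_apply] <;> ring
end

section
/- Let V be the real vector space of finitely supported sequences m : ℕ → ℝ³, and for k ∈ ℕ, l ∈ {1,2,3} let f^{k,l} : V → V be defined by (f^{k,l}(m))_i = (m_{k+i} + m_{|k−i|}) × e_l. Then for all p, q ∈ ℕ, with the bracket [A,B] := B∘A − A∘B, one has [f^{p,1}, f^{q,2}] = f^{|p−q|,3} + f^{p+q,3}. -/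
theorem cf_apply (k : ℕ) (l : Fin 3) (m : ℕ →₀ (Fin 3 → ℝ)) (i : ℕ) :
    controlField k l m i = crossProduct (m (k + i) + m (Nat.dist k i)) (stdBasis l) := rfl

theorem index_sum (g : ℕ → ℝ) (p q i : ℕ) :
    g (p + (q + i)) + g (Nat.dist p (q + i)) + (g (p + Nat.dist q i) + g (Nat.dist p (Nat.dist q i)))
      = g (Nat.dist p q + i) + g (Nat.dist (Nat.dist p q) i)
        + (g (p + q + i) + g (Nat.dist (p + q) i)) := by
  have h0 : p + (q + i) = p + q + i := by omega
  have key : (Nat.dist p (q + i) = Nat.dist p q + i ∧ p + Nat.dist q i = Nat.dist (p + q) i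
        ∧ Nat.dist p (Nat.dist q i) = Nat.dist (Nat.dist p q) i)
      ∨ (Nat.dist p (q + i) = Nat.dist p q + i ∧ p + Nat.dist q i = Nat.dist (Nat.dist p q) i
        ∧ Nat.dist p (Nat.dist q i) = Nat.dist (p + q) i)
      ∨ (Nat.dist p (q + i) = Nat.dist (Nat.dist p q) i ∧ p + Nat.dist q i = Nat.dist p q + i
        ∧ Nat.dist p (Nat.dist q i) = Nat.dist (p + q) i)
      ∨ (Nat.dist p (q + i) = Nat.dist (Nat.dist p q) i ∧ p + Nat.dist q i = Nat.dist (p + q) i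
        ∧ Nat.dist p (Nat.dist q i) = Nat.dist p q + i) := by
    unfold Nat.dist
    rcases Nat.le_total p q with h | h <;> rcases Nat.le_total i q with h' | h'
    · left; refine ⟨?_, ?_, ?_⟩ <;> omega
    · right; left; refine ⟨?_, ?_, ?_⟩ <;> omega
    · right; right; right; refine ⟨?_, ?_, ?_⟩ <;> omega
    · right; right; left; refine ⟨?_, ?_, ?_⟩ <;> omega
  rw [h0]
  rcases key with ⟨a, b, c⟩ | ⟨a, b, c⟩ | ⟨a, b, c⟩ | ⟨a, b, c⟩ <;> rw [a, b, c] <;> ring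

theorem index_comm (g : ℕ → ℝ) (p q i : ℕ) :
    g (q + (p + i)) + g (Nat.dist q (p + i)) + (g (q + Nat.dist p i) + g (Nat.dist q (Nat.dist p i)))
      = g (Nat.dist p q + i) + g (Nat.dist (Nat.dist p q) i)
        + (g (p + q + i) + g (Nat.dist (p + q) i)) := by
  rw [index_sum, Nat.dist_comm q p, add_comm q p]

/-- `[f^{p,1}, f^{q,2}] = f^{|p−q|,3} + f^{p+q,3}` for all `p q : ℕ`,
where `[A,B] = B∘A − A∘B`. -/
theorem bracket_fp1_fq2 (p q : ℕ) :
    controlField q 1 ∘ₗ controlField p 0 - controlField p 0 ∘ₗ controlField q 1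
      = controlField (Nat.dist p q) 2 + controlField (p + q) 2 := by
  refine LinearMap.ext fun m => Finsupp.ext fun i => ?_
  have h1 := index_sum (fun n => m n 1) p q i
  have h0 := index_comm (fun n => m n 0) p q i
  simp only [LinearMap.sub_apply, LinearMap.add_apply, LinearMap.comp_apply, Finsupp.sub_apply,
    Finsupp.add_apply, cf_apply]
  ext j
  fin_cases j <;> simp [cross_apply, stdBasis] <;> linarith
end

section
/- Let V be the real vector space of finitely supported sequences m : ℕ → ℝ³, and for k ∈ ℕ, l ∈ {1,2,3} let f^{k,l} : V → V be defined by (f^{k,l}(m))_i = (m_{k+i} + m_{|k−i|}) × e_l. Then for all p, q ∈ ℕ, with the bracket [A,B] := B∘A − A∘B, one has [f^{p,2}, f^{q,3}] = f^{|p−q|,1} + f^{p+q,1}. -/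
theorem controlField_natAbs (k : ℕ) (l : Fin 3) (m : ℕ →₀ (Fin 3 → ℝ)) (z : ℤ) :
    controlField k l m z.natAbs
      = crossProduct (m (z + k).natAbs + m (z - k).natAbs) (stdBasis l) := by
  change crossProduct (m (k + z.natAbs) + m (Nat.dist k z.natAbs)) (stdBasis l) = _
  congr 2
  rcases le_total 0 z with h | h
  · rw [show (z + k).natAbs = k + z.natAbs by omega,
      show (z - k).natAbs = Nat.dist k z.natAbs by unfold Nat.dist; omega]
  · rw [show (z - k).natAbs = k + z.natAbs by omega,
      show (z + k).natAbs = Nat.dist k z.natAbs by unfold Nat.dist; omega, add_comm]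

theorem cross_bracket (v : Fin 3 → ℝ) :
    crossProduct (crossProduct v (stdBasis 1)) (stdBasis 2)
      - crossProduct (crossProduct v (stdBasis 2)) (stdBasis 1)
      = crossProduct v (stdBasis 0) := by
  ext c
  fin_cases c <;> simp [cross_apply, stdBasis]

/-- `[f^{p,2}, f^{q,3}] = f^{|p−q|,1} + f^{p+q,1}` for all `p q : ℕ`,
where `[A,B] = B∘A − A∘B`. -/
theorem bracket_fp2_fq3 (p q : ℕ) :
    controlField q 2 ∘ₗ controlField p 1 - controlField p 1 ∘ₗ controlField q 2
      = controlField (Nat.dist p q) 0 + controlField (p + q) 0 := by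
  refine LinearMap.ext fun m => Finsupp.ext fun i => ?_
  have hi : i = (i : ℤ).natAbs := by simp
  rw [hi]
  generalize (i : ℤ) = z
  simp only [LinearMap.sub_apply, LinearMap.add_apply, LinearMap.comp_apply,
    Finsupp.sub_apply, Finsupp.add_apply, controlField_natAbs]
  simp only [← LinearMap.add_apply, ← map_add]
  have key : m (z + (Nat.dist p q : ℕ)).natAbs + m (z - (Nat.dist p q : ℕ)).natAbs
      = m (z + q - p).natAbs + m (z - q + p).natAbs := by
    rcases le_total p q with h | h
    · rw [Nat.dist_eq_sub_of_le h]
      congr 3 <;> omega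
    · rw [Nat.dist_eq_sub_of_le_right h, add_comm]
      congr 3 <;> omega
  rw [key, ← cross_bracket]
  have e1 : z + p + q = z + q + p := by ring
  have e2 : z + p - q = z - q + p := by ring
  have e3 : z - p + q = z + q - p := by ring
  have e4 : z - p - q = z - q - p := by ring
  have e5 : z + ((p + q : ℕ) : ℤ) = z + q + p := by push_cast; ring
  have e6 : z - ((p + q : ℕ) : ℤ) = z - q - p := by push_cast; ring
  rw [e1, e2, e3, e4, e5, e6]
  have hv : ∀ a b c d : Fin 3 → ℝ, a + b + (c + d) = c + b + (a + d) := by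
    intro a b c d
    abel
  have hw : ∀ a b c d : Fin 3 → ℝ, a + b + (c + d) = b + c + (a + d) := by
    intro a b c d
    abel
  congr 3
  · exact congrArg (fun v => crossProduct v _) (hw _ _ _ _)
  · exact congrArg (fun v => crossProduct v _) (hv _ _ _ _)
end

section
/- (Lie bracket generating property of the control vector fields, Lemma 3.1.) Let V be the real vector space of finitely supported sequences m : ℕ → ℝ³, and for k ∈ ℕ, l ∈ {1,2,3} let f^{k,l} : V → V be defined by (f^{k,l}(m))_i = (m_{k+i} + m_{|k−i|}) × e_l. Let L be the smallest linear subspace of the space of linear endomorphisms of V that contains f^{0,1}, f^{0,2} and f^{1,1} and is closed under the commutator bracket (A,B) ↦ B∘A − A∘B. Then f^{k,l} ∈ L for every k ∈ ℕ and every l ∈ {1,2,3}. -/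
theorem cf_index (m : ℕ → (Fin 3 → ℝ)) (j k i : ℕ) :
    (m (j + (k + i)) + m (Nat.dist j (k + i)))
      + (m (j + Nat.dist k i) + m (Nat.dist j (Nat.dist k i)))
    = (m (j + k + i) + m (Nat.dist (j + k) i))
      + (m (Nat.dist j k + i) + m (Nat.dist (Nat.dist j k) i)) := by
  have e0 : j + (k + i) = j + k + i := by omega
  rw [e0]
  rcases Nat.le_total i k with h1 | h1 <;> rcases Nat.le_total j k with h2 | h2
  · have e1 : j + Nat.dist k i = Nat.dist (j + k) i := by unfold Nat.dist; omega
    have e2 : Nat.dist j (k + i) = Nat.dist j k + i := by unfold Nat.dist; omega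
    have e3 : Nat.dist j (Nat.dist k i) = Nat.dist (Nat.dist j k) i := by unfold Nat.dist; omega
    rw [e1, e2, e3]; abel
  · have e1 : j + Nat.dist k i = Nat.dist (j + k) i := by unfold Nat.dist; omega
    have e2 : Nat.dist j (k + i) = Nat.dist (Nat.dist j k) i := by unfold Nat.dist; omega
    have e3 : Nat.dist j (Nat.dist k i) = Nat.dist j k + i := by unfold Nat.dist; omega
    rw [e1, e2, e3]; abel
  · have e1 : j + Nat.dist k i = Nat.dist (Nat.dist j k) i := by unfold Nat.dist; omega
    have e2 : Nat.dist j (k + i) = Nat.dist j k + i := by unfold Nat.dist; omega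
    have e3 : Nat.dist j (Nat.dist k i) = Nat.dist (j + k) i := by unfold Nat.dist; omega
    rw [e1, e2, e3]; abel
  · have e1 : j + Nat.dist k i = Nat.dist j k + i := by unfold Nat.dist; omega
    have e2 : Nat.dist j (k + i) = Nat.dist (Nat.dist j k) i := by unfold Nat.dist; omega
    have e3 : Nat.dist j (Nat.dist k i) = Nat.dist (j + k) i := by unfold Nat.dist; omega
    rw [e1, e2, e3]; abel

theorem cf_cross (v : Fin 3 → ℝ) (a : Fin 3) :
    crossProduct (crossProduct v (stdBasis a)) (stdBasis (a + 1))
      - crossProduct (crossProduct v (stdBasis (a + 1))) (stdBasis a)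
    = crossProduct v (stdBasis (a + 2)) := by
  ext c
  fin_cases a <;> fin_cases c <;> simp [cross_apply, stdBasis]

theorem cf_comp (j k : ℕ) (a b : Fin 3) (m : ℕ →₀ (Fin 3 → ℝ)) (i : ℕ) :
    controlField k b (controlField j a m) i =
      crossProduct (crossProduct ((m (j + k + i) + m (Nat.dist (j + k) i))
      + (m (Nat.dist j k + i) + m (Nat.dist (Nat.dist j k) i))) (stdBasis a)) (stdBasis b) := by
  rw [← cf_index, cf_apply, cf_apply, cf_apply, ← LinearMap.add_apply, ← map_add]

theorem cf_bracket (j k : ℕ) (a : Fin 3) :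
    controlField k (a + 1) ∘ₗ controlField j a - controlField j a ∘ₗ controlField k (a + 1)
      = controlField (j + k) (a + 2) + controlField (Nat.dist j k) (a + 2) := by
  refine LinearMap.ext fun m => Finsupp.ext fun i => ?_
  simp only [LinearMap.sub_apply, LinearMap.add_apply, LinearMap.comp_apply, Finsupp.sub_apply,
    Finsupp.add_apply]
  rw [cf_comp, cf_comp, Nat.add_comm k j, Nat.dist_comm k j, cf_cross, cf_apply, cf_apply,
    ← LinearMap.add_apply, map_add crossProduct]

/-- Lie bracket generating property (Lemma 3.1): every control vector field `f^{k,l}`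
lies in the smallest linear subspace of the linear endomorphisms of `V` which contains
`f^{0,1}, f^{0,2}, f^{1,1}` and is closed under the commutator bracket
`(A,B) ↦ B∘A − A∘B`. -/
theorem controlFields_lie_bracket_generating (k : ℕ) (l : Fin 3) :
    controlField k l ∈
      sInf {L : Submodule ℝ ((ℕ →₀ (Fin 3 → ℝ)) →ₗ[ℝ] (ℕ →₀ (Fin 3 → ℝ))) |
        controlField 0 0 ∈ L ∧ controlField 0 1 ∈ L ∧ controlField 1 0 ∈ L ∧
        ∀ A B, A ∈ L → B ∈ L → B ∘ₗ A - A ∘ₗ B ∈ L} := by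
  rw [Submodule.mem_sInf]
  rintro L ⟨h00, h01, h10, hL⟩
  have br : ∀ (j k : ℕ) (a : Fin 3), controlField j a ∈ L → controlField k (a + 1) ∈ L →
      controlField (j + k) (a + 2) + controlField (Nat.dist j k) (a + 2) ∈ L := by
    intro j k a h1 h2
    rw [← cf_bracket]
    exact hL _ _ h1 h2
  have half : ∀ A : (ℕ →₀ (Fin 3 → ℝ)) →ₗ[ℝ] (ℕ →₀ (Fin 3 → ℝ)), A + A ∈ L → A ∈ L := by
    intro A h
    have h2 := L.smul_mem (1 / 2 : ℝ) h
    rwa [← two_smul ℝ A, smul_smul, show (1 / 2 : ℝ) * 2 = 1 by norm_num, one_smul] at h2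
  have br0 : ∀ (k : ℕ) (a : Fin 3), controlField 0 a ∈ L → controlField k (a + 1) ∈ L →
      controlField k (a + 2) ∈ L := by
    intro k a h1 h2
    have h := br 0 k a h1 h2
    rw [Nat.zero_add, show Nat.dist 0 k = k by simp [Nat.dist]] at h
    exact half _ h
  have h02 : controlField 0 2 ∈ L := br0 0 0 h00 h01
  -- one component at level k gives all of them
  have all0 : ∀ k, controlField k 0 ∈ L → ∀ l, controlField k l ∈ L := by
    intro k h0
    have h1 : controlField k 1 ∈ L := br0 k 2 h02 h0
    have h2 : controlField k 2 ∈ L := br0 k 0 h00 h1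
    intro l
    fin_cases l
    · exact h0
    · exact h1
    · exact h2
  have main : ∀ k, (∀ l, controlField k l ∈ L) ∧ (∀ l, controlField (k + 1) l ∈ L) := by
    intro k
    induction k with
    | zero => exact ⟨all0 0 h00, all0 1 h10⟩
    | succ k ih =>
      refine ⟨ih.2, all0 _ ?_⟩
      have h := br 1 (k + 1) 0 h10 (ih.2 1)
      rw [show 1 + (k + 1) = k + 1 + 1 by omega,
        show Nat.dist 1 (k + 1) = k by unfold Nat.dist; omega] at h
      have h2 : controlField (k + 1 + 1) 2 ∈ L := by
        have h3 := L.add_mem h (L.smul_mem (-1 : ℝ) (ih.1 (0 + 2)))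
        have e : controlField (k + 1 + 1) (0 + 2) + controlField k (0 + 2)
            + (-1 : ℝ) • controlField k (0 + 2) = controlField (k + 1 + 1) 2 := by
          refine LinearMap.ext fun m => Finsupp.ext fun i => ?_
          simp only [LinearMap.add_apply, LinearMap.smul_apply, Finsupp.add_apply,
            Finsupp.smul_apply, zero_add]
          module
        rwa [e] at h3
      exact br0 _ 1 h01 h2
  exact (main k).1 l
end

section
/- For all natural numbers p, q, i and every function a : ℕ → ℝ, writing d(x,y) for the absolute difference |x − y| of natural numbers, one has a(d(p, q+i)) + a(p + d(q,i)) + a(d(p, d(q,i))) = a(d(p+q, i)) + a(d(p,q) + i) + a(d(d(p,q), i)); i.e., the index sums arising in the Lie bracket computation [f^{p,1}, f^{q,2}] coincide: a(|p−q−i|) + a(p+|q−i|) + a(|p−|q−i||) = a(|p+q−i|) + a(|p−q|+i) + a(||p−q|−i|). -/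
/-- The index identity arising in the Lie bracket computation `[f^{p,1}, f^{q,2}]`:
for all `p q i : ℕ` and every `a : ℕ → ℝ`, writing `Nat.dist` for the absolute
difference of natural numbers,
`a(|p−q−i|) + a(p+|q−i|) + a(|p−|q−i||) = a(|p+q−i|) + a(|p−q|+i) + a(||p−q|−i|)`. -/
theorem index_sum_identity (p q i : ℕ) (a : ℕ → ℝ) :
    a (Nat.dist p (q + i)) + a (p + Nat.dist q i) + a (Nat.dist p (Nat.dist q i))
      = a (Nat.dist (p + q) i) + a (Nat.dist p q + i) + a (Nat.dist (Nat.dist p q) i) := by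
  rcases le_total i q with hi | hi <;> rcases le_total q p with hp | hp
  · have h0 : Nat.dist p (q + i) = Nat.dist (Nat.dist p q) i := by
      simp only [Nat.dist]; omega
    have h1 : p + Nat.dist q i = Nat.dist (p + q) i := by
      simp only [Nat.dist]; omega
    have h2 : Nat.dist p (Nat.dist q i) = Nat.dist p q + i := by
      simp only [Nat.dist]; omega
    rw [h0, h1, h2]; ring
  · have h0 : Nat.dist p (q + i) = Nat.dist p q + i := by
      simp only [Nat.dist]; omega
    have h1 : p + Nat.dist q i = Nat.dist (p + q) i := by
      simp only [Nat.dist]; omega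
    have h2 : Nat.dist p (Nat.dist q i) = Nat.dist (Nat.dist p q) i := by
      simp only [Nat.dist]; omega
    rw [h0, h1, h2]; ring
  · have h0 : Nat.dist p (q + i) = Nat.dist (Nat.dist p q) i := by
      simp only [Nat.dist]; omega
    have h1 : p + Nat.dist q i = Nat.dist p q + i := by
      simp only [Nat.dist]; omega
    have h2 : Nat.dist p (Nat.dist q i) = Nat.dist (p + q) i := by
      simp only [Nat.dist]; omega
    rw [h0, h1, h2]; ring
  · have h0 : Nat.dist p (q + i) = Nat.dist p q + i := by
      simp only [Nat.dist]; omega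
    have h1 : p + Nat.dist q i = Nat.dist (Nat.dist p q) i := by
      simp only [Nat.dist]; omega
    have h2 : Nat.dist p (Nat.dist q i) = Nat.dist (p + q) i := by
      simp only [Nat.dist]; omega
    rw [h0, h1, h2]; ring
end
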